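/- arXiv:math/0306255 — 4 statements merged into one kernel-verified Lean document; each statement's English description precedes it below -/
import Mathlib

section
/- Lemma 2.2 (Sévennec), first part. The maps L : 𝒥(V, ω) → 𝒲_{J₀} and K : 𝒲_{J₀} → 𝒥(V, ω) are mutually inverse bijections: K(L(J)) = J for all J ∈ 𝒥(V, ω) and L(K(W)) = W for all W ∈ 𝒲_{J₀}. Moreover, with 𝒥(V, ω) and 𝒲_{J₀} carrying the subspace topologies induced from End(V), both L and K are continuous, so L is a homeomorphism from 𝒥(V, ω) onto 𝒲_{J₀}. -/
section Cayley

variable {V : Type*} [NormedAddCommGroup V] [NormedSpace ℝ V]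

/-- `J` is a linear complex structure compatible with the bilinear form `ω`. -/
def IsCompatibleComplexStructure (ω : V →ₗ[ℝ] V →ₗ[ℝ] ℝ) (J : V →L[ℝ] V) : Prop :=
  J * J = -1 ∧ (∀ u v : V, ω (J u) (J v) = ω u v) ∧ ∀ u : V, u ≠ 0 → 0 < ω u (J u)

/-- `W` anticommutes with `J₀`, is symmetric for `g₀ = ω(·, J₀ ·)`, and has `g₀`-operator norm
less than one. -/
def IsSymmAntiContraction (ω : V →ₗ[ℝ] V →ₗ[ℝ] ℝ) (J₀ W : V →L[ℝ] V) : Prop :=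
  W * J₀ = -(J₀ * W) ∧
    (∀ u v : V, ω (W u) (J₀ v) = ω u (J₀ (W v))) ∧
    ∃ c : ℝ, c < 1 ∧ ∀ u : V,
      Real.sqrt (ω (W u) (J₀ (W u))) ≤ c * Real.sqrt (ω u (J₀ u))

/-- The map `L(J) = -(J - J₀)(J + J₀)⁻¹`. -/
noncomputable def cayleyL (J₀ J : V →L[ℝ] V) : V →L[ℝ] V :=
  -(J - J₀) * Ring.inverse (J + J₀)

/-- The map `K(W) = J₀(1 - W)⁻¹(1 + W)`. -/
noncomputable def cayleyK (J₀ W : V →L[ℝ] V) : V →L[ℝ] V :=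
  J₀ * Ring.inverse (1 - W) * (1 + W)

variable {ω : V →ₗ[ℝ] V →ₗ[ℝ] ℝ} {J₀ J W : V →L[ℝ] V}

theorem ContinuousLinearMap.isUnit_of_injective [FiniteDimensional ℝ V] {S : V →L[ℝ] V}
    (hS : Function.Injective S) : IsUnit S := by
  have : CompleteSpace V := FiniteDimensional.complete ℝ V
  exact ContinuousLinearMap.isUnit_iff_bijective.2
    ⟨hS, (LinearMap.injective_iff_surjective (f := (S : V →ₗ[ℝ] V))).1 hS⟩

theorem ContinuousLinearMap.surjective_of_isUnit {S : V →L[ℝ] V} (hS : IsUnit S) :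
    Function.Surjective S := fun u ↦
  ⟨Ring.inverse S u, by
    rw [← mul_apply_eq_comp, Ring.mul_inverse_cancel S hS, one_apply_eq_self]⟩

theorem cayleyL_apply_add (h : IsUnit (J + J₀)) (x : V) :
    cayleyL J₀ J (J x + J₀ x) = J₀ x - J x := by
  have : cayleyL J₀ J * (J + J₀) = -(J - J₀) := by
    rw [cayleyL, mul_assoc, Ring.inverse_mul_cancel _ h, mul_one]
  simpa using DFunLike.congr_fun this x

theorem cayleyK_apply_sub (h : IsUnit (1 - W)) (x : V) :
    cayleyK J₀ W (x - W x) = J₀ x + J₀ (W x) := by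
  have hcomm : (1 + W) * (1 - W) = (1 - W) * (1 + W) := by noncomm_ring
  have : cayleyK J₀ W * (1 - W) = J₀ * (1 + W) := by
    rw [cayleyK, mul_assoc, hcomm, mul_assoc, ← mul_assoc _ (1 - W),
      Ring.inverse_mul_cancel _ h, one_mul]
  simpa using DFunLike.congr_fun this x

theorem apply_apply_of_anticommute (hW : W * J₀ = -(J₀ * W)) (x : V) :
    W (J₀ x) = -J₀ (W x) := by
  simpa using DFunLike.congr_fun hW x

namespace IsCompatibleComplexStructure

theorem apply_apply (hJ : IsCompatibleComplexStructure ω J) (x : V) : J (J x) = -x := by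
  simpa using DFunLike.congr_fun hJ.1 x

theorem apply_left (hJ : IsCompatibleComplexStructure ω J) (x y : V) :
    ω (J x) y = -ω x (J y) := by
  have h := hJ.2.1 x (J y)
  rw [hJ.apply_apply, map_neg] at h
  linarith

theorem nonneg (hJ : IsCompatibleComplexStructure ω J) (x : V) : 0 ≤ ω x (J x) := by
  rcases eq_or_ne x 0 with rfl | hx
  · simp
  · exact (hJ.2.2 x hx).le

theorem isUnit_add [FiniteDimensional ℝ V] (hJ : IsCompatibleComplexStructure ω J)
    (hJ₀ : IsCompatibleComplexStructure ω J₀) : IsUnit (J + J₀) := by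
  refine ContinuousLinearMap.isUnit_of_injective ((injective_iff_map_eq_zero _).2 fun x hx ↦ ?_)
  by_contra hne
  have h : ω x ((J + J₀) x) = 0 := by rw [hx, map_zero]
  rw [add_apply, map_add] at h
  linarith [hJ.2.2 x hne, hJ₀.2.2 x hne]

end IsCompatibleComplexStructure

theorem IsSymmAntiContraction.apply_lt (hJ₀ : IsCompatibleComplexStructure ω J₀)
    (hW : IsSymmAntiContraction ω J₀ W) {u : V} (hu : u ≠ 0) :
    ω (W u) (J₀ (W u)) < ω u (J₀ u) := by
  obtain ⟨-, -, c, hc, h⟩ := hW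
  have hpos := Real.sqrt_pos.2 (hJ₀.2.2 u hu)
  refine (Real.sqrt_lt_sqrt_iff (hJ₀.nonneg _)).1 ((h u).trans_lt ?_)
  nlinarith

theorem IsSymmAntiContraction.isUnit_one_sub [FiniteDimensional ℝ V]
    (hJ₀ : IsCompatibleComplexStructure ω J₀) (hW : IsSymmAntiContraction ω J₀ W) :
    IsUnit (1 - W) := by
  refine ContinuousLinearMap.isUnit_of_injective ((injective_iff_map_eq_zero _).2 fun x hx ↦ ?_)
  by_contra hne
  have hWx : W x = x := (sub_eq_zero.1 hx).symm
  have h := hW.apply_lt hJ₀ hne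
  rw [hWx] at h
  exact lt_irrefl _ h

/-- In finite dimension a pointwise strict `g₀`-contraction is a uniform one. -/
theorem exists_contraction_constant [FiniteDimensional ℝ V]
    (hJ₀ : IsCompatibleComplexStructure ω J₀)
    (h : ∀ u : V, u ≠ 0 → ω (W u) (J₀ (W u)) < ω u (J₀ u)) :
    ∃ c : ℝ, c < 1 ∧ ∀ u : V,
      Real.sqrt (ω (W u) (J₀ (W u))) ≤ c * Real.sqrt (ω u (J₀ u)) := by
  rcases subsingleton_or_nontrivial V with hV | hV
  · exact ⟨0, one_pos, fun u ↦ by simp [Subsingleton.elim u 0]⟩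
  have hω : Continuous fun p : V × V ↦ ω p.1 p.2 := by
    have h₁ : Continuous (LinearMap.toContinuousLinearMap.toLinearMap ∘ₗ ω) :=
      LinearMap.continuous_of_finiteDimensional _
    exact (h₁.comp continuous_fst).clm_apply continuous_snd
  have hg : Continuous fun u ↦ Real.sqrt (ω u (J₀ u)) :=
    (hω.comp (continuous_id.prodMk J₀.continuous)).sqrt
  have hne {u : V} (hu : u ∈ Metric.sphere (0 : V) 1) : u ≠ 0 :=
    ne_zero_of_mem_unit_sphere ⟨u, hu⟩
  have := FiniteDimensional.proper ℝ V
  obtain ⟨x, hx, hmax⟩ := (isCompact_sphere (0 : V) 1).exists_isMaxOn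
    (NormedSpace.sphere_nonempty.2 zero_le_one)
    (f := fun u ↦ Real.sqrt (ω (W u) (J₀ (W u))) / Real.sqrt (ω u (J₀ u)))
    ((hg.comp W.continuous).continuousOn.div hg.continuousOn
      fun u hu ↦ (Real.sqrt_pos.2 (hJ₀.2.2 u (hne hu))).ne')
  refine ⟨_, (div_lt_one (Real.sqrt_pos.2 (hJ₀.2.2 x (hne hx)))).2
    (Real.sqrt_lt_sqrt (hJ₀.nonneg _) (h x (hne hx))), fun u ↦ ?_⟩
  rcases eq_or_ne u 0 with rfl | hu
  · simp
  have hu' : 0 < ‖u‖⁻¹ := inv_pos.2 (norm_pos_iff.2 hu)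
  have hscale (v : V) : Real.sqrt (ω (‖u‖⁻¹ • v) (J₀ (‖u‖⁻¹ • v))) =
      ‖u‖⁻¹ * Real.sqrt (ω v (J₀ v)) := by
    rw [map_smul, map_smul, map_smul, LinearMap.smul_apply, smul_eq_mul, smul_eq_mul, ← mul_assoc,
      Real.sqrt_mul (by positivity), Real.sqrt_mul_self hu'.le]
  have hle := hmax (show ‖u‖⁻¹ • u ∈ Metric.sphere (0 : V) 1 by
    simp [norm_smul, norm_ne_zero_iff.2 hu])
  simp only [Set.mem_ofPred_eq, map_smul W] at hle
  rw [hscale, hscale, mul_div_mul_left _ _ hu'.ne'] at hle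
  exact (div_le_iff₀ (Real.sqrt_pos.2 (hJ₀.2.2 u hu))).1 hle

theorem cayleyL_mem [FiniteDimensional ℝ V]
    (hJ₀ : IsCompatibleComplexStructure ω J₀) (hJ : IsCompatibleComplexStructure ω J) :
    IsSymmAntiContraction ω J₀ (cayleyL J₀ J) := by
  have hS := hJ.isUnit_add hJ₀
  have hsurj (u : V) : ∃ x, J x + J₀ x = u := ContinuousLinearMap.surjective_of_isUnit hS u
  refine ⟨?_, fun u v ↦ ?_, exists_contraction_constant hJ₀ fun u hu ↦ ?_⟩
  · ext u
    obtain ⟨x, rfl⟩ := hsurj u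
    have h : J₀ (J x + J₀ x) = J (J x) + J₀ (J x) := by
      rw [map_add, hJ.apply_apply, hJ₀.apply_apply, add_comm]
    simp only [mul_apply_eq_comp, neg_apply]
    rw [h, cayleyL_apply_add hS, cayleyL_apply_add hS, map_sub, hJ.apply_apply, hJ₀.apply_apply]
    abel
  · obtain ⟨x, rfl⟩ := hsurj u
    obtain ⟨y, rfl⟩ := hsurj v
    rw [cayleyL_apply_add hS, cayleyL_apply_add hS]
    simp only [map_add, map_sub, map_neg, LinearMap.add_apply, LinearMap.sub_apply,
      hJ₀.apply_apply, hJ₀.2.1, hJ.apply_left]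
    linarith
  · obtain ⟨x, rfl⟩ := hsurj u
    have hx : x ≠ 0 := by rintro rfl; simp at hu
    rw [cayleyL_apply_add hS]
    simp only [map_add, map_sub, map_neg, LinearMap.add_apply, LinearMap.sub_apply,
      hJ₀.apply_apply, hJ₀.2.1, hJ.apply_left]
    linarith [hJ.2.2 x hx]

theorem cayleyK_mem [FiniteDimensional ℝ V]
    (hJ₀ : IsCompatibleComplexStructure ω J₀) (hW : IsSymmAntiContraction ω J₀ W) :
    IsCompatibleComplexStructure ω (cayleyK J₀ W) := by
  have hA := hW.isUnit_one_sub hJ₀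
  have hsurj (u : V) : ∃ x, x - W x = u := ContinuousLinearMap.surjective_of_isUnit hA u
  have hanti := apply_apply_of_anticommute hW.1
  have hskew (x y : V) : ω (W x) y = -ω x (W y) := by
    have h := hW.2.1 x (J₀ y)
    rw [hanti, hJ₀.apply_apply, map_neg, map_neg, hJ₀.apply_apply, neg_neg] at h
    linarith
  refine ⟨?_, fun u v ↦ ?_, fun u hu ↦ ?_⟩
  · ext u
    obtain ⟨x, rfl⟩ := hsurj u
    have h : J₀ x + J₀ (W x) = J₀ x - W (J₀ x) := by rw [hanti, sub_neg_eq_add]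
    simp only [mul_apply_eq_comp, neg_apply,
      one_apply_eq_self]
    rw [cayleyK_apply_sub hA, h, cayleyK_apply_sub hA, hanti, map_neg, hJ₀.apply_apply,
      hJ₀.apply_apply]
    abel
  · obtain ⟨x, rfl⟩ := hsurj u
    obtain ⟨y, rfl⟩ := hsurj v
    rw [cayleyK_apply_sub hA, cayleyK_apply_sub hA, ← map_add, ← map_add, hJ₀.2.1]
    simp only [map_add, map_sub, LinearMap.add_apply, LinearMap.sub_apply, hskew]
    ring
  · obtain ⟨x, rfl⟩ := hsurj u
    have hx : x ≠ 0 := by rintro rfl; simp at hu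
    rw [cayleyK_apply_sub hA]
    simp only [map_add, map_sub, LinearMap.sub_apply]
    linarith [hW.apply_lt hJ₀ hx, hW.2.1 x x]

theorem cayleyK_cayleyL [FiniteDimensional ℝ V]
    (hJ₀ : IsCompatibleComplexStructure ω J₀) (hJ : IsCompatibleComplexStructure ω J) :
    cayleyK J₀ (cayleyL J₀ J) = J := by
  have hS := hJ.isUnit_add hJ₀
  have hA := (cayleyL_mem hJ₀ hJ).isUnit_one_sub hJ₀
  have key (x : V) : cayleyK J₀ (cayleyL J₀ J) ((2 : ℝ) • J x) = J ((2 : ℝ) • J x) := by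
    have h := cayleyK_apply_sub (J₀ := J₀) hA (J x + J₀ x)
    rw [cayleyL_apply_add hS, ← map_add,
      show J x + J₀ x - (J₀ x - J x) = (2 : ℝ) • J x by module,
      show J x + J₀ x + (J₀ x - J x) = (2 : ℝ) • J₀ x by module] at h
    rw [h, map_smul, map_smul, hJ.apply_apply, hJ₀.apply_apply]
  ext u
  have hu : (2 : ℝ) • J (-(2⁻¹ : ℝ) • J u) = u := by
    rw [map_smul, hJ.apply_apply]
    module
  simpa only [hu] using key (-(2⁻¹ : ℝ) • J u)

theorem cayleyL_cayleyK [FiniteDimensional ℝ V]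
    (hJ₀ : IsCompatibleComplexStructure ω J₀) (hW : IsSymmAntiContraction ω J₀ W) :
    cayleyL J₀ (cayleyK J₀ W) = W := by
  have hA := hW.isUnit_one_sub hJ₀
  have hS := (cayleyK_mem hJ₀ hW).isUnit_add hJ₀
  have key (x : V) : cayleyL J₀ (cayleyK J₀ W) ((2 : ℝ) • J₀ x) = W ((2 : ℝ) • J₀ x) := by
    have h := cayleyL_apply_add hS (x - W x)
    rw [cayleyK_apply_sub hA, map_sub,
      show J₀ x + J₀ (W x) + (J₀ x - J₀ (W x)) = (2 : ℝ) • J₀ x by module,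
      show J₀ x - J₀ (W x) - (J₀ x + J₀ (W x)) = (2 : ℝ) • -J₀ (W x) by module] at h
    rw [h, map_smul, apply_apply_of_anticommute hW.1]
  ext u
  have hu : (2 : ℝ) • J₀ (-(2⁻¹ : ℝ) • J₀ u) = u := by
    rw [map_smul, hJ₀.apply_apply]
    module
  simpa only [hu] using key (-(2⁻¹ : ℝ) • J₀ u)

theorem continuousOn_ringInverse [CompleteSpace V] :
    ContinuousOn Ring.inverse {S : V →L[ℝ] V | IsUnit S} := by
  rintro _ ⟨S, rfl⟩
  exact (NormedRing.inverse_continuousAt S).continuousWithinAt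

theorem continuousOn_cayleyL [FiniteDimensional ℝ V]
    (hJ₀ : IsCompatibleComplexStructure ω J₀) :
    ContinuousOn (cayleyL J₀) {J | IsCompatibleComplexStructure ω J} := by
  have := FiniteDimensional.complete ℝ V
  have hinv : ContinuousOn (fun J : V →L[ℝ] V ↦ Ring.inverse (J + J₀))
      {J | IsCompatibleComplexStructure ω J} :=
    continuousOn_ringInverse.comp (by fun_prop) fun J hJ ↦ hJ.isUnit_add hJ₀
  exact ContinuousOn.mul (by fun_prop) hinv

theorem continuousOn_cayleyK [FiniteDimensional ℝ V]
    (hJ₀ : IsCompatibleComplexStructure ω J₀) :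
    ContinuousOn (cayleyK J₀) {W | IsSymmAntiContraction ω J₀ W} := by
  have := FiniteDimensional.complete ℝ V
  have hinv : ContinuousOn (fun W : V →L[ℝ] V ↦ Ring.inverse (1 - W))
      {W | IsSymmAntiContraction ω J₀ W} :=
    continuousOn_ringInverse.comp (by fun_prop) fun W hW ↦ hW.isUnit_one_sub hJ₀
  exact (continuousOn_const.mul hinv).mul (by fun_prop)

end Cayley

/-- Lemma 2.2 (Sévennec), first part: the Cayley maps
`L(J) = -(J - J₀)(J + J₀)⁻¹` and `K(W) = J₀(id - W)⁻¹(id + W)` are mutually inverse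
bijections between `𝒥(V, ω)` and `𝒲_{J₀}`, and both are continuous (for the norm
topology on endomorphisms), so `L` is a homeomorphism from `𝒥(V, ω)` onto `𝒲_{J₀}`. -/
theorem sevennec_cayley_homeomorphism
    (V : Type*) [NormedAddCommGroup V] [NormedSpace ℝ V] [FiniteDimensional ℝ V]
    (ω : V →ₗ[ℝ] V →ₗ[ℝ] ℝ)
    (hω_alt : ∀ u : V, ω u u = 0)
    (hω_nondeg : ∀ u : V, (∀ v : V, ω u v = 0) → u = 0)
    (J₀ : V →L[ℝ] V)
    (hJ₀_sq : J₀ * J₀ = -1)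
    (hJ₀_compat : ∀ u v : V, ω (J₀ u) (J₀ v) = ω u v)
    (hJ₀_pos : ∀ u : V, u ≠ 0 → 0 < ω u (J₀ u))
    (𝒥 : Set (V →L[ℝ] V))
    (h𝒥 : 𝒥 = {J : V →L[ℝ] V | J * J = -1 ∧ (∀ u v : V, ω (J u) (J v) = ω u v) ∧
      ∀ u : V, u ≠ 0 → 0 < ω u (J u)})
    (𝒲 : Set (V →L[ℝ] V))
    (h𝒲 : 𝒲 = {W : V →L[ℝ] V | W * J₀ = -(J₀ * W) ∧
      (∀ u v : V, ω (W u) (J₀ v) = ω u (J₀ (W v))) ∧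
      ∃ c : ℝ, c < 1 ∧ ∀ u : V,
        Real.sqrt (ω (W u) (J₀ (W u))) ≤ c * Real.sqrt (ω u (J₀ u))})
    (L : (V →L[ℝ] V) → (V →L[ℝ] V))
    (hL : ∀ J : V →L[ℝ] V, L J = -(J - J₀) * Ring.inverse (J + J₀))
    (K : (V →L[ℝ] V) → (V →L[ℝ] V))
    (hK : ∀ W : V →L[ℝ] V, K W = J₀ * Ring.inverse (1 - W) * (1 + W)) :
    (∀ J ∈ 𝒥, L J ∈ 𝒲) ∧
    (∀ W ∈ 𝒲, K W ∈ 𝒥) ∧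
    (∀ J ∈ 𝒥, K (L J) = J) ∧
    (∀ W ∈ 𝒲, L (K W) = W) ∧
    ContinuousOn L 𝒥 ∧
    ContinuousOn K 𝒲 := by
  obtain rfl : L = cayleyL J₀ := funext hL
  obtain rfl : K = cayleyK J₀ := funext hK
  subst h𝒥 h𝒲
  have hJ₀ : IsCompatibleComplexStructure ω J₀ := ⟨hJ₀_sq, hJ₀_compat, hJ₀_pos⟩
  exact ⟨fun _ hJ ↦ cayleyL_mem hJ₀ hJ, fun _ hW ↦ cayleyK_mem hJ₀ hW,
    fun _ hJ ↦ cayleyK_cayleyL hJ₀ hJ, fun _ hW ↦ cayleyL_cayleyK hJ₀ hW,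
    continuousOn_cayleyL hJ₀, continuousOn_cayleyK hJ₀⟩
end

section
/- Lemma 2.2, second part. Suppose W ∈ 𝒲_{J₀} and α₀ ∈ (0, 1) are such that J := K(W) satisfies g_J(v, v) ≥ α₀ g₀(v, v) for all v ∈ V. Then for every t ∈ [0, 1] one has tW ∈ 𝒲_{J₀}, the endomorphism J_t := K(tW) is an ω-compatible linear complex structure on V, and g_{J_t}(v, v) ≥ α₀ g₀(v, v) for all v ∈ V. -/
section CayleyTransform

variable {V : Type*} [AddCommGroup V] [Module ℝ V]

/-- The Cayley transform of `S` sends `(1 - S) p` to `J₀ ((1 + S) p)`. -/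
lemma cayley_apply_one_sub {J₀ S : Module.End ℝ V} (hS : IsUnit (1 - S)) (p : V) :
    (J₀ * Ring.inverse (1 - S) * (1 + S)) (p - S p) = J₀ (p + S p) := by
  have h : J₀ * Ring.inverse (1 - S) * (1 + S) * (1 - S) = J₀ * (1 + S) := by
    rw [mul_assoc, show (1 + S) * (1 - S) = (1 - S) * (1 + S) by noncomm_ring, ← mul_assoc,
      mul_assoc J₀, Ring.inverse_mul_cancel _ hS, mul_one]
  simpa using LinearMap.congr_fun h p

/-- The Cayley transform of an endomorphism anticommuting with a complex structure is again
a complex structure. -/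
lemma cayley_mul_self {J₀ S : Module.End ℝ V} (hS : IsUnit (1 - S)) (hJ₀ : J₀ * J₀ = -1)
    (hanti : S * J₀ = -(J₀ * S)) :
    (J₀ * Ring.inverse (1 - S) * (1 + S)) * (J₀ * Ring.inverse (1 - S) * (1 + S)) = -1 := by
  have h₁ : (1 + S) * J₀ = J₀ * (1 - S) := by rw [add_mul, hanti]; noncomm_ring
  have h₂ : J₀ * (1 + S) = (1 - S) * J₀ := by rw [sub_mul, hanti]; noncomm_ring
  calc (J₀ * Ring.inverse (1 - S) * (1 + S)) * (J₀ * Ring.inverse (1 - S) * (1 + S))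
      = J₀ * Ring.inverse (1 - S) * ((1 + S) * J₀) * Ring.inverse (1 - S) * (1 + S) := by
        simp only [mul_assoc]
    _ = J₀ * Ring.inverse (1 - S) * (J₀ * (1 + S)) := by
        rw [h₁]
        simp only [mul_assoc]
        rw [Ring.mul_inverse_cancel_left _ _ hS]
    _ = -1 := by
        rw [h₂, mul_assoc, Ring.inverse_mul_cancel_left _ _ hS, hJ₀]

variable {ω : V →ₗ[ℝ] V →ₗ[ℝ] ℝ} {J₀ S : Module.End ℝ V}

lemma compatible_form_symm (hω : ω.IsAlt) (hsq : J₀ * J₀ = -1)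
    (hcompat : ∀ u v : V, ω (J₀ u) (J₀ v) = ω u v) (u v : V) :
    ω u (J₀ v) = ω v (J₀ u) := by
  have hJJ : J₀ (J₀ v) = -v := by simpa using LinearMap.congr_fun hsq v
  rw [← hcompat u, hJJ, map_neg, hω.neg]

/-- A self-adjoint endomorphism anticommuting with `J₀` is infinitesimally symplectic. -/
lemma apply_left_eq_neg_apply_right (hsq : J₀ * J₀ = -1) (hanti : S * J₀ = -(J₀ * S))
    (hadj : ∀ u v : V, ω (S u) (J₀ v) = ω u (J₀ (S v))) (p q : V) :
    ω (S p) q = -ω p (S q) := by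
  have hJJ : J₀ (J₀ q) = -q := by simpa using LinearMap.congr_fun hsq q
  have hSJ : J₀ (S (J₀ q)) = S q := by
    have h := LinearMap.congr_fun hanti (J₀ q)
    simp only [Module.End.mul_apply, LinearMap.neg_apply, hJJ, map_neg] at h
    exact (neg_injective h).symm
  have h := hadj p (J₀ q)
  rw [hJJ, hSJ, map_neg] at h
  linarith

lemma form_one_sub_one_add (hω : ω.IsAlt) (hsq : J₀ * J₀ = -1)
    (hcompat : ∀ u v : V, ω (J₀ u) (J₀ v) = ω u v) (p : V) :
    ω (p - S p) (J₀ (p + S p)) = ω p (J₀ p) - ω (S p) (J₀ (S p)) := by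
  have h := compatible_form_symm hω hsq hcompat p (S p)
  simp only [map_add, map_sub, LinearMap.sub_apply]
  linarith

lemma form_one_sub_one_sub (hω : ω.IsAlt) (hsq : J₀ * J₀ = -1)
    (hcompat : ∀ u v : V, ω (J₀ u) (J₀ v) = ω u v) (p : V) :
    ω (p - S p) (J₀ (p - S p)) =
      ω p (J₀ p) - 2 * ω p (J₀ (S p)) + ω (S p) (J₀ (S p)) := by
  have h := compatible_form_symm hω hsq hcompat p (S p)
  simp only [map_sub, LinearMap.sub_apply]
  linarith

lemma form_apply_lt_of_contraction (hpos : ∀ u : V, u ≠ 0 → 0 < ω u (J₀ u))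
    (hnorm : ∃ c : ℝ, c < 1 ∧ ∀ u : V, √(ω (S u) (J₀ (S u))) ≤ c * √(ω u (J₀ u)))
    {u : V} (hu : u ≠ 0) : ω (S u) (J₀ (S u)) < ω u (J₀ u) := by
  obtain ⟨c, hc, h⟩ := hnorm
  have hsqrt : 0 < √(ω u (J₀ u)) := Real.sqrt_pos.2 (hpos u hu)
  exact (Real.sqrt_lt_sqrt_iff_of_pos (hpos u hu)).1 (by nlinarith [h u])

lemma isUnit_one_sub_of_form_lt [FiniteDimensional ℝ V]
    (hlt : ∀ u : V, u ≠ 0 → ω (S u) (J₀ (S u)) < ω u (J₀ u)) : IsUnit (1 - S) := by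
  rw [LinearMap.isUnit_iff_ker_eq_bot, LinearMap.ker_eq_bot']
  intro u hu
  by_contra hne
  have hSu : S u = u := (sub_eq_zero.1 (by simpa using hu)).symm
  simpa [hSu] using hlt u hne

lemma exists_sub_apply_eq (hS : IsUnit (1 - S)) (u : V) : ∃ p, p - S p = u := by
  obtain ⟨p, hp⟩ := ((Module.End.isUnit_iff _).1 hS).surjective u
  exact ⟨p, by simpa using hp⟩

lemma contraction_smul {t : ℝ} (ht : t ∈ Set.Icc (0 : ℝ) 1)
    (hnorm : ∃ c : ℝ, c < 1 ∧ ∀ u : V, √(ω (S u) (J₀ (S u))) ≤ c * √(ω u (J₀ u))) :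
    ∃ c : ℝ, c < 1 ∧
      ∀ u : V, √(ω ((t • S) u) (J₀ ((t • S) u))) ≤ c * √(ω u (J₀ u)) := by
  obtain ⟨c, hc, h⟩ := hnorm
  have htc : t * c < 1 := by
    rcases le_total 0 c with h0 | h0
    · exact (mul_le_of_le_one_left h0 ht.2).trans_lt hc
    · exact (mul_nonpos_of_nonneg_of_nonpos ht.1 h0).trans_lt one_pos
  refine ⟨t * c, htc, fun u ↦ ?_⟩
  have hform : ω ((t • S) u) (J₀ ((t • S) u)) = t ^ 2 * ω (S u) (J₀ (S u)) := by
    simp only [LinearMap.smul_apply, map_smul, smul_eq_mul]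
    ring
  rw [hform, Real.sqrt_mul (sq_nonneg t), Real.sqrt_sq ht.1, mul_assoc]
  exact mul_le_mul_of_nonneg_left (h u) ht.1

end CayleyTransform


/-- Lemma 2.2, second part: if `W ∈ 𝒲_{J₀}` and `α₀ ∈ (0,1)` are such that
`J := K(W)` satisfies `g_J(v,v) ≥ α₀ g₀(v,v)` for all `v`, then for every `t ∈ [0,1]`
one has `tW ∈ 𝒲_{J₀}`, `J_t := K(tW)` is an `ω`-compatible linear complex structure,
and `g_{J_t}(v,v) ≥ α₀ g₀(v,v)` for all `v`. -/
theorem cayley_path_lower_bound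
    (V : Type*) [AddCommGroup V] [Module ℝ V] [FiniteDimensional ℝ V]
    (ω : V →ₗ[ℝ] V →ₗ[ℝ] ℝ)
    (hω_alt : ∀ u : V, ω u u = 0)
    (hω_nondeg : ∀ u : V, (∀ v : V, ω u v = 0) → u = 0)
    (J₀ : Module.End ℝ V)
    (hJ₀_sq : J₀ * J₀ = -1)
    (hJ₀_compat : ∀ u v : V, ω (J₀ u) (J₀ v) = ω u v)
    (hJ₀_pos : ∀ u : V, u ≠ 0 → 0 < ω u (J₀ u))
    (W : Module.End ℝ V)
    (hW_anti : W * J₀ = -(J₀ * W))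
    (hW_selfadj : ∀ u v : V, ω (W u) (J₀ v) = ω u (J₀ (W v)))
    (hW_norm : ∃ c : ℝ, c < 1 ∧ ∀ u : V,
      Real.sqrt (ω (W u) (J₀ (W u))) ≤ c * Real.sqrt (ω u (J₀ u)))
    (α₀ : ℝ) (hα₀ : α₀ ∈ Set.Ioo (0 : ℝ) 1)
    (h_bound : ∀ v : V,
      α₀ * ω v (J₀ v) ≤ ω v ((J₀ * Ring.inverse (1 - W) * (1 + W)) v)) :
    ∀ t ∈ Set.Icc (0 : ℝ) 1,
      ((t • W) * J₀ = -(J₀ * (t • W)) ∧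
        (∀ u v : V, ω ((t • W) u) (J₀ v) = ω u (J₀ ((t • W) v))) ∧
        (∃ c : ℝ, c < 1 ∧ ∀ u : V,
          Real.sqrt (ω ((t • W) u) (J₀ ((t • W) u))) ≤ c * Real.sqrt (ω u (J₀ u)))) ∧
      ∀ Jt : Module.End ℝ V, Jt = J₀ * Ring.inverse (1 - t • W) * (1 + t • W) →
        (Jt * Jt = -1) ∧
        (∀ u v : V, ω (Jt u) (Jt v) = ω u v) ∧
        (∀ u : V, u ≠ 0 → 0 < ω u (Jt u)) ∧
        (∀ v : V, α₀ * ω v (J₀ v) ≤ ω v (Jt v)) := by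
  intro t ht
  have hanti : (t • W) * J₀ = -(J₀ * (t • W)) := by
    rw [smul_mul_assoc, hW_anti, mul_smul_comm, smul_neg]
  have hadj : ∀ u v : V, ω ((t • W) u) (J₀ v) = ω u (J₀ ((t • W) v)) := fun u v ↦ by
    simp [hW_selfadj]
  have hnorm := contraction_smul ht hW_norm
  have hWunit : IsUnit (1 - W) := isUnit_one_sub_of_form_lt
    fun u hu ↦ form_apply_lt_of_contraction hJ₀_pos hW_norm hu
  have hlt : ∀ u : V, u ≠ 0 → ω ((t • W) u) (J₀ ((t • W) u)) < ω u (J₀ u) :=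
    fun u hu ↦ form_apply_lt_of_contraction hJ₀_pos hnorm hu
  have hunit : IsUnit (1 - t • W) := isUnit_one_sub_of_form_lt hlt
  refine ⟨⟨hanti, hadj, hnorm⟩, ?_⟩
  rintro _ rfl
  refine ⟨cayley_mul_self hunit hJ₀_sq hanti, fun u v ↦ ?_, fun u hu ↦ ?_, fun v ↦ ?_⟩
  · obtain ⟨p, rfl⟩ := exists_sub_apply_eq hunit u
    obtain ⟨q, rfl⟩ := exists_sub_apply_eq hunit v
    have h := apply_left_eq_neg_apply_right hJ₀_sq hanti hadj p q
    rw [cayley_apply_one_sub hunit, cayley_apply_one_sub hunit, hJ₀_compat]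
    simp only [map_add, map_sub, LinearMap.add_apply, LinearMap.sub_apply]
    linarith
  · obtain ⟨p, rfl⟩ := exists_sub_apply_eq hunit u
    rw [cayley_apply_one_sub hunit, form_one_sub_one_add hω_alt hJ₀_sq hJ₀_compat, sub_pos]
    exact hlt p (by rintro rfl; simp at hu)
  · obtain ⟨p, rfl⟩ := exists_sub_apply_eq hunit v
    rw [cayley_apply_one_sub hunit, form_one_sub_one_add hω_alt hJ₀_sq hJ₀_compat,
      form_one_sub_one_sub hω_alt hJ₀_sq hJ₀_compat]
    have hb := h_bound (p - W p)
    rw [cayley_apply_one_sub hWunit, form_one_sub_one_add hω_alt hJ₀_sq hJ₀_compat,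
      form_one_sub_one_sub hω_alt hJ₀_sq hJ₀_compat] at hb
    have hnonneg : ∀ u : V, 0 ≤ ω u (J₀ u) := fun u ↦ by
      rcases eq_or_ne u 0 with rfl | hu
      · simp
      · exact (hJ₀_pos u hu).le
    -- the inequality is concave in `t` and holds at both endpoints
    have hconcave : 0 ≤ (1 + α₀) * (t * (1 - t)) * ω (W p) (J₀ (W p)) :=
      mul_nonneg (mul_nonneg (by linarith [hα₀.1])
        (mul_nonneg ht.1 (sub_nonneg.2 ht.2))) (hnonneg _)
    have hzero : 0 ≤ (1 - t) * ((1 - α₀) * ω p (J₀ p)) :=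
      mul_nonneg (sub_nonneg.2 ht.2) (mul_nonneg (by linarith [hα₀.2]) (hnonneg _))
    have hone := mul_le_mul_of_nonneg_left hb ht.1
    simp only [LinearMap.smul_apply, map_smul, smul_eq_mul]
    linarith
end

section
/- Lemma 3.11. Under the stated hypotheses: (0) each V_I is an open subset of X; (1) the family {V_I : I ∈ 𝒩} is an open covering of ⋃_{i=1}^n W_i^1; (2) V_I ⊆ W_I for every I ∈ 𝒩; (3) for I, J ∈ 𝒩, if closure(V_I) ∩ V_J ≠ ∅ then I ⊆ J or J ⊆ I (in fact closure(V_I) ∩ V_J ≠ ∅ already implies V_I ∩ V_J ≠ ∅); and (4) for every nonempty open subset 𝒲* ⊆ ⋃_{i=1}^n W_i^1, setting V_I* := V_I ∩ 𝒲* and W_I* := W_I ∩ 𝒲*, the family {V_I* : I ∈ 𝒩} is an open covering of 𝒲*, V_I* ⊆ W_I* for every I ∈ 𝒩, and closure(V_I*) ∩ V_J* ≠ ∅ implies I ⊆ J or J ⊆ I. -/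
theorem isClosed_biUnion_biInter_closure {X ι : Type*} [TopologicalSpace X] [Finite ι]
    (S : Set (Finset ι)) (A : ι → Set X) :
    IsClosed (⋃ J ∈ S, ⋂ j ∈ J, closure (A j)) :=
  S.toFinite.isClosed_biUnion fun _ _ ↦ isClosed_biInter fun _ _ ↦ isClosed_closure

theorem subset_of_forall_subset_succ {X : Type*} {n : ℕ} {A : ℕ → Set X}
    (h : ∀ j, 1 ≤ j → j ≤ n - 1 → A j ⊆ A (j + 1)) {a b : ℕ} (ha : 1 ≤ a) (hab : a ≤ b)
    (hb : b ≤ n) : A a ⊆ A b := by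
  induction b, hab using Nat.le_induction with
  | base => exact subset_rfl
  | succ b hab ih => exact (ih (by omega)).trans (h b (by omega) (by omega))

/-- Lemma 3.11: for the shrinking families `W_i^j ⊂⊂ U_i^j ⊂⊂ W_i^{j+1}` with
`⋂ᵢ W_i = ∅`, the sets `V_I` (for `I ∈ 𝒩`) are open, cover `⋃ᵢ W_i^1`, satisfy
`V_I ⊆ W_I`, the closure of `V_I` meets `V_J` only if `I ⊆ J` or `J ⊆ I` (in which
case already `V_I ∩ V_J ≠ ∅`), and the corresponding statements hold after
intersecting with any nonempty open subset `𝒲* ⊆ ⋃ᵢ W_i^1`. -/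
theorem lemma_3_11
    (X : Type*) [TopologicalSpace X]
    (n : ℕ) (hn : 2 ≤ n)
    (W U : Fin n → ℕ → Set X)
    (hWopen : ∀ (i : Fin n) (j : ℕ), 1 ≤ j → j ≤ n → IsOpen (W i j))
    (hUopen : ∀ (i : Fin n) (j : ℕ), 1 ≤ j → j ≤ n - 1 → IsOpen (U i j))
    (hWU : ∀ (i : Fin n) (j : ℕ), 1 ≤ j → j ≤ n - 1 → closure (W i j) ⊆ U i j)
    (hUW : ∀ (i : Fin n) (j : ℕ), 1 ≤ j → j ≤ n - 1 → closure (U i j) ⊆ W i (j + 1))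
    (hempty : (⋂ i : Fin n, W i n) = ∅)
    (𝒩 : Set (Finset (Fin n)))
    (h𝒩 : 𝒩 = {I : Finset (Fin n) | I.Nonempty ∧ (⋂ i ∈ I, W i n).Nonempty})
    (Vset : Finset (Fin n) → Set X)
    (hV : ∀ I : Finset (Fin n),
      Vset I = (⋂ i ∈ I, W i I.card) \
        closure (⋃ J ∈ {J : Finset (Fin n) | I.card < J.card},
          ⋂ j ∈ J, closure (U j I.card))) :
    (∀ I ∈ 𝒩, IsOpen (Vset I)) ∧
    ((⋃ i : Fin n, W i 1) ⊆ ⋃ I ∈ 𝒩, Vset I) ∧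
    (∀ I ∈ 𝒩, Vset I ⊆ ⋂ i ∈ I, W i n) ∧
    (∀ I ∈ 𝒩, ∀ J ∈ 𝒩, (closure (Vset I) ∩ Vset J).Nonempty → I ⊆ J ∨ J ⊆ I) ∧
    (∀ I ∈ 𝒩, ∀ J ∈ 𝒩, (closure (Vset I) ∩ Vset J).Nonempty →
      (Vset I ∩ Vset J).Nonempty) ∧
    (∀ Wstar : Set X, Wstar.Nonempty → IsOpen Wstar →
      Wstar ⊆ (⋃ i : Fin n, W i 1) →
      (Wstar ⊆ ⋃ I ∈ 𝒩, (Vset I ∩ Wstar)) ∧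
      (∀ I ∈ 𝒩, Vset I ∩ Wstar ⊆ (⋂ i ∈ I, W i n) ∩ Wstar) ∧
      (∀ I ∈ 𝒩, ∀ J ∈ 𝒩,
        (closure (Vset I ∩ Wstar) ∩ (Vset J ∩ Wstar)).Nonempty → I ⊆ J ∨ J ⊆ I)) := by
  classical
  have hclosed (I : Finset (Fin n)) := isClosed_biUnion_biInter_closure
    {J : Finset (Fin n) | I.card < J.card} (fun j ↦ U j I.card)
  have hmono (i : Fin n) {a b : ℕ} (ha : 1 ≤ a) (hab : a ≤ b) (hb : b ≤ n) : W i a ⊆ W i b :=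
    subset_of_forall_subset_succ (fun j h₁ h₂ ↦ subset_closure.trans
      ((hWU i j h₁ h₂).trans (subset_closure.trans (hUW i j h₁ h₂)))) ha hab hb
  have hmem (I : Finset (Fin n)) (x : X) : x ∈ Vset I ↔ (∀ i ∈ I, x ∈ W i I.card) ∧
      ∀ J : Finset (Fin n), I.card < J.card → ¬ ∀ j ∈ J, x ∈ closure (U j I.card) := by
    rw [hV, (hclosed I).closure_eq]
    simp only [Set.mem_sdiff, Set.mem_iInter, Set.mem_iUnion, Set.mem_ofPred_eq, exists_prop,
      not_exists, not_and]
  have hcard_le (I : Finset (Fin n)) : I.card ≤ n := by simpa using I.card_le_univ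
  have hcard_lt {I : Finset (Fin n)} {x : X} (hx : ∀ i ∈ I, x ∈ W i n) : I.card ≤ n - 1 := by
    by_contra! hlt
    have hI : I = Finset.univ := by
      rw [← Finset.card_eq_iff_eq_univ, Fintype.card_fin]
      have := hcard_le I
      omega
    subst hI
    have : x ∈ ⋂ i : Fin n, W i n := Set.mem_iInter.2 fun i ↦ hx i (Finset.mem_univ i)
    simp [hempty] at this
  have h𝒩card {I : Finset (Fin n)} (hI : I ∈ 𝒩) : 1 ≤ I.card ∧ I.card ≤ n - 1 := by
    rw [h𝒩] at hI
    obtain ⟨hne, x, hx⟩ := hI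
    exact ⟨hne.card_pos, hcard_lt (by simpa using hx)⟩
  have hVopen (I) (hI : I ∈ 𝒩) : IsOpen (Vset I) := by
    rw [hV]
    exact (isOpen_biInter_finset fun i _ ↦ hWopen i _ (h𝒩card hI).1 (hcard_le I)).sdiff
      isClosed_closure
  have hcover : (⋃ i : Fin n, W i 1) ⊆ ⋃ I ∈ 𝒩, Vset I := by
    intro x hx
    obtain ⟨i, hi⟩ := Set.mem_iUnion.1 hx
    obtain ⟨I, hI, hmax⟩ := Finset.exists_max_image
      (Finset.univ.filter fun I : Finset (Fin n) ↦ I.Nonempty ∧ ∀ i ∈ I, x ∈ W i I.card)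
      Finset.card ⟨{i}, by simpa using hi⟩
    simp only [Finset.mem_filter, Finset.mem_univ, true_and] at hI hmax
    have hpos := hI.1.card_pos
    have hxn : ∀ i ∈ I, x ∈ W i n := fun i hi ↦ hmono i hpos (hcard_le I) le_rfl (hI.2 i hi)
    have hlt := hcard_lt hxn
    refine Set.mem_biUnion (x := I) ?_ ((hmem I x).2 ⟨hI.2, fun J hJ hxJ ↦ ?_⟩)
    · rw [h𝒩]
      exact ⟨hI.1, x, by simpa using hxn⟩
    · refine hJ.not_ge (hmax J ⟨Finset.card_pos.1 (by omega), fun j hj ↦ ?_⟩)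
      exact hmono j (by omega) hJ (hcard_le J) (hUW j _ hpos hlt (hxJ j hj))
  have hsub (I) (hI : I ∈ 𝒩) : Vset I ⊆ ⋂ i ∈ I, W i n := fun x hx ↦
    Set.mem_iInter₂.2 fun i hi ↦
      hmono i (h𝒩card hI).1 (hcard_le I) le_rfl (((hmem I x).1 hx).1 i hi)
  have hinter (I) (J) (hJ : J ∈ 𝒩) (h : (closure (Vset I) ∩ Vset J).Nonempty) :
      (Vset I ∩ Vset J).Nonempty :=
    (closure_inter_open_nonempty_iff (hVopen J hJ)).1 h
  have hle {I J} (hI : I ∈ 𝒩) (hJ : J ∈ 𝒩) (hIJ : I.card ≤ J.card) {x : X} (hxI : x ∈ Vset I)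
      (hxJ : x ∈ Vset J) : I ⊆ J := by
    by_contra hns
    have hlt : J.card < (I ∪ J).card := Finset.card_lt_card
      ⟨Finset.subset_union_right, fun h ↦ hns (Finset.subset_union_left.trans h)⟩
    obtain ⟨hJ₁, hJ₂⟩ := h𝒩card hJ
    refine ((hmem J x).1 hxJ).2 _ hlt fun j hj ↦
      subset_closure (hWU j _ hJ₁ hJ₂ (subset_closure ?_))
    rcases Finset.mem_union.1 hj with hj | hj
    · exact hmono j (h𝒩card hI).1 hIJ (hcard_le J) (((hmem I x).1 hxI).1 j hj)
    · exact ((hmem J x).1 hxJ).1 j hj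
  have hcomp (I) (hI : I ∈ 𝒩) (J) (hJ : J ∈ 𝒩) (h : (closure (Vset I) ∩ Vset J).Nonempty) :
      I ⊆ J ∨ J ⊆ I := by
    obtain ⟨x, hxI, hxJ⟩ := hinter I J hJ h
    exact (le_total I.card J.card).imp (hle hI hJ · hxI hxJ) (hle hJ hI · hxJ hxI)
  refine ⟨hVopen, hcover, hsub, hcomp, fun I _ J hJ ↦ hinter I J hJ, fun Wstar _ _ hW ↦
    ⟨fun x hx ↦ ?_, fun I hI ↦ Set.inter_subset_inter_left _ (hsub I hI), fun I hI J hJ h ↦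
      hcomp I hI J hJ (h.mono (Set.inter_subset_inter (closure_mono Set.inter_subset_left)
        Set.inter_subset_left))⟩⟩
  obtain ⟨I, hI, hxI⟩ := Set.mem_iUnion₂.1 (hcover (hW hx))
  exact Set.mem_biUnion hI ⟨hxI, hx⟩
end

section
/- Separation from unused covering sets (proved in the proof of Lemma 3.12, equation (3.69)). Under the stated hypotheses, let I ∈ 𝒩 with |I| = k and let l ∈ {1, …, n} with l ∉ I. Then V_I ⊆ (⋂_{i∈I} closure(W_i^k)) \ W_l^1; since this set is closed, also closure(V_I) ⊆ (⋂_{i∈I} closure(W_i^k)) \ W_l^1, and in particular closure(V_I) ∩ W_l^1 = ∅. -/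
/-- An alternating chain of sets `W 1 ⊂⊂ U 1 ⊂⊂ W 2 ⊂⊂ ⋯ ⊂⊂ W n` is increasing:
its first member is contained in every `W k`. -/
theorem first_subset_of_closure_subset_chain {X : Type*} [TopologicalSpace X] {n : ℕ}
    {W U : ℕ → Set X}
    (hWU : ∀ j, 1 ≤ j → j ≤ n - 1 → closure (W j) ⊆ U j)
    (hUW : ∀ j, 1 ≤ j → j ≤ n - 1 → closure (U j) ⊆ W (j + 1))
    {k : ℕ} (hk : 1 ≤ k) (hkn : k ≤ n) : W 1 ⊆ W k := by
  induction k, hk using Nat.le_induction with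
  | base => exact subset_rfl
  | succ k hk ih =>
    have hkn' : k ≤ n - 1 := by omega
    exact (ih (by omega)).trans <| subset_closure.trans <| (hWU k hk hkn').trans <|
      subset_closure.trans (hUW k hk hkn')


/-- Separation from unused covering sets (equation (3.69) in the proof of Lemma 3.12):
for `I ∈ 𝒩` with `|I| = k` and `l ∉ I`, one has
`V_I ⊆ (⋂_{i ∈ I} closure(W_i^k)) \ W_l^1`; since this set is closed, also
`closure(V_I) ⊆ (⋂_{i ∈ I} closure(W_i^k)) \ W_l^1`, and in particular
`closure(V_I) ∩ W_l^1 = ∅`. -/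
theorem separation_from_unused_sets
    (X : Type*) [TopologicalSpace X]
    (n : ℕ) (hn : 2 ≤ n)
    (W U : Fin n → ℕ → Set X)
    (hWopen : ∀ (i : Fin n) (j : ℕ), 1 ≤ j → j ≤ n → IsOpen (W i j))
    (hUopen : ∀ (i : Fin n) (j : ℕ), 1 ≤ j → j ≤ n - 1 → IsOpen (U i j))
    (hWU : ∀ (i : Fin n) (j : ℕ), 1 ≤ j → j ≤ n - 1 → closure (W i j) ⊆ U i j)
    (hUW : ∀ (i : Fin n) (j : ℕ), 1 ≤ j → j ≤ n - 1 → closure (U i j) ⊆ W i (j + 1))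
    (hempty : (⋂ i : Fin n, W i n) = ∅)
    (𝒩 : Set (Finset (Fin n)))
    (h𝒩 : 𝒩 = {I : Finset (Fin n) | I.Nonempty ∧ (⋂ i ∈ I, W i n).Nonempty})
    (Vset : Finset (Fin n) → Set X)
    (hV : ∀ I : Finset (Fin n),
      Vset I = (⋂ i ∈ I, W i I.card) \
        closure (⋃ J ∈ {J : Finset (Fin n) | I.card < J.card},
          ⋂ j ∈ J, closure (U j I.card))) :
    ∀ I ∈ 𝒩, ∀ l : Fin n, l ∉ I →
      Vset I ⊆ (⋂ i ∈ I, closure (W i I.card)) \ W l 1 ∧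
      closure (Vset I) ⊆ (⋂ i ∈ I, closure (W i I.card)) \ W l 1 ∧
      closure (Vset I) ∩ W l 1 = ∅ := by
  intro I hI l hl
  rw [h𝒩] at hI
  have hk : 1 ≤ I.card := hI.1.card_pos
  have hkn : I.card ≤ n - 1 := by
    have h := Finset.card_lt_univ_of_notMem hl
    rw [Fintype.card_fin] at h
    omega
  have hsub : Vset I ⊆ (⋂ i ∈ I, closure (W i I.card)) \ W l 1 := by
    rw [hV]
    rintro x ⟨hxW, hxU⟩
    rw [Set.mem_iInter₂] at hxW
    refine ⟨Set.mem_iInter₂.2 fun i hi => subset_closure (hxW i hi), fun hxl => hxU ?_⟩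
    have hxlk : x ∈ W l I.card :=
      first_subset_of_closure_subset_chain (hWU l) (hUW l) hk (by omega) hxl
    refine subset_closure (Set.mem_iUnion₂.2 ⟨insert l I, ?_, Set.mem_iInter₂.2 fun j hj => ?_⟩)
    · simp [Finset.card_insert_of_notMem hl]
    · have hxj : x ∈ W j I.card := by
        rcases Finset.mem_insert.1 hj with rfl | hj
        · exact hxlk
        · exact hxW j hj
      exact subset_closure (hWU j _ hk hkn (subset_closure hxj))
  have hclosed : IsClosed ((⋂ i ∈ I, closure (W i I.card)) \ W l 1) :=
    (isClosed_biInter fun _ _ => isClosed_closure).sdiff (hWopen l 1 le_rfl (by omega))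
  have hcl := closure_minimal hsub hclosed
  exact ⟨hsub, hcl, Set.disjoint_iff_inter_eq_empty.1 <|
    Set.disjoint_left.2 fun _ hx => (hcl hx).2⟩
end
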